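/- Let p be a prime, let a ≥ b ≥ c ≥ 0 be integers, and let r be a positive integer with a·r < p and (a+b+c)·r < 2p. Let f = x^a y^b (x+y)^c ∈ 𝔽_p[x,y]. Then: (i) if a ≥ b + c, then dim_{𝔽_p} 𝔽_p[x,y]/(x^p, y^p, f^r) = (a+b+c)rp − a(b+c)r²; (ii) if a < b + c, then dim_{𝔽_p} 𝔽_p[x,y]/(x^p, y^p, f^r) = (a+b+c)rp − ⌊(a+b+c)²r²/4⌋. -/

import Mathlib

namespace Polynomial

variable {K : Type*} [Field K]

/-- Below the characteristic, a vanishing Wronskian forces equal degrees. -/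
theorem natDegree_eq_of_wronskian_eq_zero {p : ℕ} [CharP K p] {f g : K[X]} (hf : f ≠ 0)
    (hg : g ≠ 0) (hfp : f.natDegree < p) (hgp : g.natDegree < p) (h : wronskian f g = 0) :
    f.natDegree = g.natDegree := by
  have h0 : f * (derivative g * X) = derivative f * X * g := by
    rw [wronskian] at h
    linear_combination X * h
  have hcoeff : ∀ (q : K[X]) (i : ℕ), (derivative q * X).coeff i = (i : K) * q.coeff i := by
    intro q i
    cases i with
    | zero => simp
    | succ i => rw [coeff_mul_X, coeff_derivative]; push_cast; ring
  have hdeg : ∀ q : K[X], (derivative q * X).natDegree ≤ q.natDegree := by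
    intro q
    rw [natDegree_le_iff_coeff_eq_zero]
    intro i hi
    rw [hcoeff, coeff_eq_zero_of_natDegree_lt hi, mul_zero]
  have h1 : (f * (derivative g * X)).coeff (f.natDegree + g.natDegree) =
      (derivative f * X * g).coeff (f.natDegree + g.natDegree) := by rw [h0]
  rw [coeff_mul_add_eq_of_natDegree_le le_rfl (hdeg g),
    coeff_mul_add_eq_of_natDegree_le (hdeg f) le_rfl,
    hcoeff, hcoeff] at h1
  have hf' : f.coeff f.natDegree ≠ 0 := leadingCoeff_ne_zero.mpr hf
  have hg' : g.coeff g.natDegree ≠ 0 := leadingCoeff_ne_zero.mpr hg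
  have h2 : (g.natDegree : K) = (f.natDegree : K) := by
    apply mul_right_cancel₀ (mul_ne_zero hf' hg')
    linear_combination h1
  exact (CharP.natCast_injOn_Iio K p hgp hfp h2).symm

/-- Below the characteristic, a vanishing Wronskian forces proportionality. -/
theorem exists_eq_C_mul_of_wronskian_eq_zero {p : ℕ} [CharP K p] {f g : K[X]} (hf : f ≠ 0)
    (hfp : f.natDegree < p) (hgp : g.natDegree < p) (h : wronskian f g = 0) :
    ∃ a : K, g = C a * f := by
  by_cases hg : g = 0
  · exact ⟨0, by simp [hg]⟩
  have hd := natDegree_eq_of_wronskian_eq_zero hf hg hfp hgp h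
  have hf' : f.leadingCoeff ≠ 0 := leadingCoeff_ne_zero.mpr hf
  set a := g.leadingCoeff / f.leadingCoeff
  refine ⟨a, ?_⟩
  by_contra hne
  have hsub : g - C a * f ≠ 0 := sub_ne_zero.mpr hne
  have hle : (g - C a * f).natDegree ≤ f.natDegree :=
    (natDegree_sub_le _ _).trans (max_le hd.ge (natDegree_C_mul_le _ _))
  have hw : wronskian f (g - C a * f) = 0 := by
    rw [wronskian] at h ⊢
    rw [derivative_sub, derivative_C_mul]
    linear_combination h
  have hd' := natDegree_eq_of_wronskian_eq_zero hf hsub hfp (hle.trans_lt hfp) hw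
  apply hsub
  rw [← leadingCoeff_eq_zero, leadingCoeff, ← hd', coeff_sub, coeff_C_mul]
  nth_rewrite 1 [hd]
  change g.leadingCoeff - a * f.leadingCoeff = 0
  rw [div_mul_cancel₀ _ hf', sub_self]

theorem pow_pred_dvd_derivative {q f : K[X]} {m : ℕ} (h : q ^ m ∣ f) :
    q ^ (m - 1) ∣ derivative f := by
  obtain ⟨g, rfl⟩ := h
  rw [derivative_mul, derivative_pow]
  refine dvd_add ?_ ((pow_dvd_pow q (Nat.sub_le m 1)).mul_right _)
  exact (((dvd_refl _).mul_left _).mul_right _).mul_right _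

theorem pow_pred_dvd_wronskian_left {q f : K[X]} {m : ℕ} (g : K[X]) (h : q ^ m ∣ f) :
    q ^ (m - 1) ∣ wronskian f g :=
  dvd_sub (((pow_dvd_pow q (Nat.sub_le m 1)).trans h).mul_right _)
    ((pow_pred_dvd_derivative h).mul_right _)

theorem isCoprime_X_X_add_one : IsCoprime (X : K[X]) (X + 1) :=
  ⟨-1, 1, by ring⟩

theorem natDegree_X_add_one_pow (c : ℕ) : ((X + 1 : K[X]) ^ c).natDegree = c := by
  rw [natDegree_pow, ← C_1, natDegree_X_add_C, mul_one]

/-- There is no low-degree syzygy between (the dehomogenizations of) `x ^ m`, `y ^ n` and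
`(x + y) ^ c`. -/
theorem eq_zero_of_syzygy {p : ℕ} [CharP K p] {m n c d : ℕ} (hm : 1 ≤ m) (hc : 1 ≤ c)
    (hdp : d < p) (hd : 2 * d + 2 ≤ m + n + c) (hmn : d < m + n) (hmc : d < m + c)
    (hnc : d < n + c) {u v w : K[X]} (hu : u ∈ degreeLT K (d + 1 - m))
    (hv : v ∈ degreeLT K (d + 1 - n)) (hw : w ∈ degreeLT K (d + 1 - c))
    (h : u * X ^ m + v + w * (X + 1) ^ c = 0) : u = 0 ∧ v = 0 ∧ w = 0 := by
  have key : ∀ {q : K[X]} {k : ℕ}, q ∈ degreeLT K (d + 1 - k) → q ≠ 0 → q.natDegree + k ≤ d := by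
    intro q k hq hq0
    rw [mem_degreeLT, ← natDegree_lt_iff_degree_lt hq0] at hq
    omega
  have hX1 : (X + 1 : K[X]) ≠ 0 := by
    rw [← C_1]; exact X_add_C_ne_zero 1
  have hXc : (X + 1 : K[X]) ^ c ≠ 0 := pow_ne_zero _ hX1
  have hXm : (X : K[X]) ^ m ≠ 0 := pow_ne_zero _ X_ne_zero
  have hcop : ∀ i j, IsCoprime ((X : K[X]) ^ i) ((X + 1) ^ j) := fun i j =>
    isCoprime_X_X_add_one.pow
  by_cases hu0 : u = 0
  · subst hu0
    by_cases hw0 : w = 0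
    · subst hw0; simpa using h
    · exfalso
      have hv' : v = -(w * (X + 1) ^ c) := by linear_combination h
      have hv0 : v ≠ 0 := by rw [hv']; exact neg_ne_zero.mpr (mul_ne_zero hw0 hXc)
      have h1 := key hv hv0
      rw [hv', natDegree_neg, natDegree_mul hw0 hXc, natDegree_X_add_one_pow] at h1
      omega
  have hU0 : u * X ^ m ≠ 0 := mul_ne_zero hu0 hXm
  have hUd := key hu hu0
  by_cases hw0 : w = 0
  · exfalso
    subst hw0
    have hv' : v = -(u * X ^ m) := by linear_combination h
    have hv0 : v ≠ 0 := by rw [hv']; exact neg_ne_zero.mpr hU0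
    have h1 := key hv hv0
    rw [hv', natDegree_neg, natDegree_mul hu0 hXm, natDegree_X_pow] at h1
    omega
  exfalso
  have hwd := key hw hw0
  by_cases hv0 : v = 0
  · subst hv0
    have h1 : X ^ m ∣ w * (X + 1) ^ c := ⟨-u, by linear_combination h⟩
    have h2 := (hcop m c).dvd_of_dvd_mul_right h1
    have h3 := natDegree_le_of_dvd h2 hw0
    rw [natDegree_X_pow] at h3
    omega
  have hvd := key hv hv0
  have hUdeg : (u * X ^ m).natDegree = u.natDegree + m := by
    rw [natDegree_mul hu0 hXm, natDegree_X_pow]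
  have hdvdV : ∀ f : K[X], f ≠ 0 → X ^ (m - 1) ∣ f → (X + 1) ^ (c - 1) ∣ f →
      (m - 1) + (c - 1) ≤ f.natDegree := by
    intro f hf h1 h2
    have h3 := natDegree_le_of_dvd ((hcop _ _).mul_dvd h1 h2) hf
    rwa [natDegree_mul (pow_ne_zero _ X_ne_zero) (pow_ne_zero _ hX1), natDegree_X_pow,
      natDegree_X_add_one_pow] at h3
  by_cases hW : wronskian (u * X ^ m) v = 0
  · obtain ⟨a, ha⟩ := exists_eq_C_mul_of_wronskian_eq_zero (p := p) hv0 (by omega)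
      (show (u * X ^ m).natDegree < p by omega)
      (by rw [← wronskian_neg_eq, hW, neg_zero])
    have h1 : (u * X ^ m).natDegree ≤ v.natDegree := by
      rw [ha]; exact natDegree_C_mul_le _ _
    have h2 : w * (X + 1) ^ c = C (-1 - a) * v := by
      rw [C_sub, C_neg, C_1]
      linear_combination h - ha
    have h3 : c ≤ v.natDegree := by
      have h4 : (w * (X + 1) ^ c).natDegree ≤ v.natDegree := by
        rw [h2]; exact natDegree_C_mul_le _ _
      rw [natDegree_mul hw0 hXc, natDegree_X_add_one_pow] at h4
      omega
    have h4 : X ^ m ∣ C (-1 - a) * v := by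
      have ha0 : a ≠ 0 := by rintro rfl; simp at ha; tauto
      refine Dvd.dvd.mul_left ⟨C a⁻¹ * u, ?_⟩ _
      have : C a⁻¹ * (u * X ^ m) = v := by
        rw [ha, ← mul_assoc, ← C_mul, inv_mul_cancel₀ ha0, C_1, one_mul]
      linear_combination -this
    rw [← h2] at h4
    have h5 := natDegree_le_of_dvd ((hcop m c).dvd_of_dvd_mul_right h4) hw0
    rw [natDegree_X_pow] at h5
    omega
  · have h1 := natDegree_wronskian_lt_add hW
    have h2 := hdvdV _ hW (pow_pred_dvd_wronskian_left v ⟨u, by ring⟩) (by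
      rw [wronskian_eq_of_sum_zero h, wronskian_eq_of_sum_zero
        (show v + w * (X + 1) ^ c + u * X ^ m = 0 by linear_combination h)]
      exact pow_pred_dvd_wronskian_left _ ⟨w, by ring⟩)
    omega

end Polynomial

namespace MvPolynomial

open Polynomial (degreeLT homogenize mem_degreeLT)

variable {K : Type*} [Field K]

/-- The dehomogenization (`x ↦ X`, `y ↦ 1`) of the degree `e` component of a polynomial. -/
noncomputable def dehomogenize (e : ℕ) : MvPolynomial (Fin 2) K →ₗ[K] Polynomial K :=
  (aeval ![Polynomial.X, 1]).toLinearMap ∘ₗ homogeneousComponent e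

theorem homogenize_dehomogenize (e : ℕ) (f : MvPolynomial (Fin 2) K) :
    homogenize (dehomogenize e f) e = homogeneousComponent e f :=
  Polynomial.homogenize_eq_of_isHomogeneous (homogeneousComponent_isHomogeneous e f) rfl

theorem mem_degreeLT_succ_iff {q : Polynomial K} {e : ℕ} :
    q ∈ degreeLT K (e + 1) ↔ q.natDegree ≤ e := by
  by_cases hq : q = 0
  · simp [hq]
  rw [mem_degreeLT, ← Polynomial.natDegree_lt_iff_degree_lt hq, Nat.lt_succ_iff]

theorem dehomogenize_mem_degreeLT (e : ℕ) (f : MvPolynomial (Fin 2) K) :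
    dehomogenize e f ∈ degreeLT K (e + 1) := by
  rw [mem_degreeLT_succ_iff]
  have := aeval_natDegree_le (homogeneousComponent e f)
    (homogeneousComponent_isHomogeneous e f).totalDegree_le ![(Polynomial.X : Polynomial K), 1]
    (n := 1) (by intro i; fin_cases i <;> simp)
  simpa [dehomogenize] using this

theorem dehomogenize_homogenize {e : ℕ} {q : Polynomial K} (hq : q ∈ degreeLT K (e + 1)) :
    dehomogenize e (homogenize q e) = q := by
  rw [mem_degreeLT_succ_iff] at hq
  rw [dehomogenize, LinearMap.comp_apply, homogeneousComponent_eq_self (by simp)]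
  exact Polynomial.aeval_homogenize_X_one q hq

theorem dehomogenize_homogenize_of_ne {e d : ℕ} (q : Polynomial K) (h : e ≠ d) :
    dehomogenize e (homogenize q d) = 0 := by
  rw [dehomogenize, LinearMap.comp_apply,
    homogeneousComponent_of_mem (Polynomial.isHomogeneous_homogenize q), if_neg h, map_zero]

theorem dehomogenize_mul_of_isHomogeneous {i : ℕ} {g : MvPolynomial (Fin 2) K}
    (hg : g.IsHomogeneous i) (f : MvPolynomial (Fin 2) K) (e : ℕ) :
    dehomogenize e (f * g) =
      if i ≤ e then dehomogenize (e - i) f * aeval ![Polynomial.X, 1] g else 0 := by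
  let _ : GradedAlgebra (homogeneousSubmodule (Fin 2) K) := gradedAlgebra
  have h := DirectSum.coe_decompose_mul_of_right_mem (homogeneousSubmodule (Fin 2) K) (a := f) e
    ((mem_homogeneousSubmodule i g).mpr hg)
  have h' : homogeneousComponent e (f * g) =
    if i ≤ e then homogeneousComponent (e - i) f * g else 0 := by
    rw [← decomposition.decompose'_apply, ← decomposition.decompose'_apply]
    exact h
  rw [dehomogenize, LinearMap.comp_apply, h']
  split_ifs <;> simp [dehomogenize]

theorem mul_mem_degreeLT {u q : Polynomial K} {e m : ℕ} (hu : u ∈ degreeLT K (e + 1 - m))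
    (hq : q.natDegree ≤ m) : u * q ∈ degreeLT K (e + 1) := by
  by_cases hu0 : u = 0
  · simp [hu0]
  rw [mem_degreeLT, ← Polynomial.natDegree_lt_iff_degree_lt hu0] at hu
  rw [mem_degreeLT_succ_iff]
  exact Polynomial.natDegree_mul_le.trans (by omega)

/-- The map `(u, v, w) ↦ u x ^ m + v y ^ n + w (x + y) ^ c` into degree `e`, dehomogenized. -/
noncomputable def combination (K : Type*) [Field K] (m n c e : ℕ) :
    degreeLT K (e + 1 - m) × degreeLT K (e + 1 - n) × degreeLT K (e + 1 - c) →ₗ[K]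
      degreeLT K (e + 1) where
  toFun t := ⟨t.1.1 * Polynomial.X ^ m + t.2.1.1 * 1 + t.2.2.1 * (Polynomial.X + 1) ^ c,
    add_mem (add_mem (mul_mem_degreeLT t.1.2 (Polynomial.natDegree_X_pow m).le)
      (mul_mem_degreeLT t.2.1.2 (by simp)))
      (mul_mem_degreeLT t.2.2.2 (Polynomial.natDegree_X_add_one_pow c).le)⟩
  map_add' s t := by
    ext1
    simp only [Prod.fst_add, Prod.snd_add, Submodule.coe_add]
    ring
  map_smul' a t := by
    ext1
    simp only [Prod.smul_fst, Prod.smul_snd, Submodule.coe_smul, RingHom.id_apply,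
      Polynomial.smul_eq_C_mul]
    ring

theorem combination_injective {p : ℕ} [CharP K p] {m n c e : ℕ} (hm : 1 ≤ m) (hc : 1 ≤ c)
    (hep : e < p) (he : 2 * e + 2 ≤ m + n + c) (hmn : e < m + n) (hmc : e < m + c)
    (hnc : e < n + c) : Function.Injective (combination K m n c e) := by
  rw [← LinearMap.ker_eq_bot, LinearMap.ker_eq_bot']
  rintro ⟨⟨u, hu⟩, ⟨v, hv⟩, ⟨w, hw⟩⟩ h
  have h' := congrArg Subtype.val h
  simp only [combination, LinearMap.coe_mk, AddHom.coe_mk, mul_one, ZeroMemClass.coe_zero] at h'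
  obtain ⟨rfl, rfl, rfl⟩ := Polynomial.eq_zero_of_syzygy hm hc hep he hmn hmc hnc hu hv hw h'
  rfl

theorem finrank_degreeLT (n : ℕ) : Module.finrank K (degreeLT K n) = n := by
  rw [Module.finrank_eq_card_basis (Polynomial.degreeLT.basis K n), Fintype.card_fin]

/-- The ideal generated by `x ^ m`, `y ^ n` and `(x + y) ^ c`. -/
noncomputable def powerIdeal (K : Type*) [Field K] (m n c : ℕ) : Ideal (MvPolynomial (Fin 2) K) :=
  Ideal.span {X 0 ^ m, X 1 ^ n, (X 0 + X 1) ^ c}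

theorem isHomogeneous_X_add_X_pow (c : ℕ) :
    ((X 0 + X 1 : MvPolynomial (Fin 2) K) ^ c).IsHomogeneous c := by
  simpa using ((isHomogeneous_X K (0 : Fin 2)).add (isHomogeneous_X K 1)).pow c

theorem mem_span_triple {R : Type*} [CommRing R] {f g h z : R} :
    z ∈ Ideal.span {f, g, h} ↔ ∃ u v w, u * f + v * g + w * h = z := by
  simp only [Ideal.mem_span_insert, Ideal.mem_span_singleton']
  constructor
  · rintro ⟨u, _, ⟨v, _, ⟨w, rfl⟩, rfl⟩, rfl⟩
    exact ⟨u, v, w, by ring⟩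
  · rintro ⟨u, v, w, rfl⟩
    exact ⟨u, _, ⟨v, _, ⟨w, rfl⟩, rfl⟩, by ring⟩

theorem exists_combination_of_mem {m n c : ℕ} {f : MvPolynomial (Fin 2) K}
    (hf : f ∈ powerIdeal K m n c) (e : ℕ) :
    ∃ t, (combination K m n c e t : Polynomial K) = dehomogenize e f := by
  obtain ⟨u, v, w, rfl⟩ := mem_span_triple.mp hf
  have key : ∀ (i : ℕ) (g q : MvPolynomial (Fin 2) K), g.IsHomogeneous i →
      ∃ s : degreeLT K (e + 1 - i),
        dehomogenize e (q * g) = s.1 * aeval ![Polynomial.X, 1] g := by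
    intro i g q hg
    rw [dehomogenize_mul_of_isHomogeneous hg]
    split_ifs with hi
    · refine ⟨⟨dehomogenize (e - i) q, ?_⟩, rfl⟩
      rw [Nat.sub_add_comm hi]
      exact dehomogenize_mem_degreeLT _ _
    · exact ⟨0, by simp⟩
  obtain ⟨s₁, h₁⟩ := key m (X 0 ^ m) u (isHomogeneous_X_pow 0 m)
  obtain ⟨s₂, h₂⟩ := key n (X 1 ^ n) v (isHomogeneous_X_pow 1 n)
  obtain ⟨s₃, h₃⟩ := key c _ w (isHomogeneous_X_add_X_pow c)
  refine ⟨(s₁, s₂, s₃), ?_⟩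
  rw [map_add, map_add, h₁, h₂, h₃]
  simp [combination]

theorem homogenize_mul_mem {I : Ideal (MvPolynomial (Fin 2) K)} {u q : Polynomial K} {e m : ℕ}
    (hu : u ∈ degreeLT K (e + 1 - m)) (hq : q.natDegree ≤ m) (hI : homogenize q m ∈ I) :
    homogenize (u * q) e ∈ I := by
  by_cases hu0 : u = 0
  · simp [hu0]
  rw [mem_degreeLT, ← Polynomial.natDegree_lt_iff_degree_lt hu0] at hu
  obtain ⟨k, rfl⟩ : ∃ k, e = k + m := ⟨e - m, by omega⟩
  rw [Polynomial.homogenize_mul u q (by omega) hq]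
  exact I.mul_mem_left _ hI

theorem homogenize_X_add_one_pow (c : ℕ) :
    homogenize ((Polynomial.X + 1 : Polynomial K) ^ c) c = (X 0 + X 1) ^ c :=
  Polynomial.homogenize_eq_of_isHomogeneous (isHomogeneous_X_add_X_pow c) (by simp)

theorem homogenize_combination_mem {m n c e : ℕ}
    (t : degreeLT K (e + 1 - m) × degreeLT K (e + 1 - n) × degreeLT K (e + 1 - c)) :
    homogenize (combination K m n c e t : Polynomial K) e ∈ powerIdeal K m n c := by
  simp only [combination, LinearMap.coe_mk, AddHom.coe_mk, Polynomial.homogenize_add]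
  refine add_mem (add_mem ?_ ?_) ?_
  · refine homogenize_mul_mem t.1.2 (Polynomial.natDegree_X_pow m).le (Ideal.subset_span ?_)
    rw [Polynomial.homogenize_X_pow le_rfl]
    simp
  · refine homogenize_mul_mem t.2.1.2 (by simp) (Ideal.subset_span ?_)
    simp
  · refine homogenize_mul_mem t.2.2.2 (Polynomial.natDegree_X_add_one_pow c).le
      (Ideal.subset_span ?_)
    rw [homogenize_X_add_one_pow]
    simp

/-- The ideal `(x ^ m, y ^ n, (x + y) ^ c)` contains every form of degree `e` as soon as the
dehomogenized generators span that degree. -/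
theorem mem_powerIdeal_of_isHomogeneous {m n c e : ℕ}
    (h : Function.Surjective (combination K m n c e)) {f : MvPolynomial (Fin 2) K}
    (hf : f.IsHomogeneous e) : f ∈ powerIdeal K m n c := by
  obtain ⟨t, ht⟩ := h ⟨dehomogenize e f, dehomogenize_mem_degreeLT e f⟩
  have := homogenize_combination_mem t
  rwa [ht, homogenize_dehomogenize, homogeneousComponent_eq_self hf] at this

theorem combination_surjective {p : ℕ} [CharP K p] {m n c e : ℕ} (hm : 1 ≤ m) (hc : 1 ≤ c)
    (hep : e < p) (he : 2 * e + 2 = m + n + c) (hmn : e < m + n) (hmc : e < m + c)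
    (hnc : e < n + c) : Function.Surjective (combination K m n c e) := by
  refine (LinearMap.injective_iff_surjective_of_finrank_eq_finrank ?_).mp
    (combination_injective hm hc hep he.le hmn hmc hnc)
  rw [Module.finrank_prod, Module.finrank_prod, finrank_degreeLT, finrank_degreeLT,
    finrank_degreeLT, finrank_degreeLT]
  omega

theorem mem_of_isHomogeneous_of_le {I : Ideal (MvPolynomial (Fin 2) K)} {e d : ℕ}
    (h : ∀ f : MvPolynomial (Fin 2) K, f.IsHomogeneous e → f ∈ I) (hed : e ≤ d)
    {f : MvPolynomial (Fin 2) K} (hf : f.IsHomogeneous d) : f ∈ I := by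
  rw [f.as_sum]
  refine sum_mem fun s hs => ?_
  have hs' : s.degree = d := by
    by_contra hne
    exact (mem_support_iff.mp hs) (hf.coeff_eq_zero hne)
  rw [Finsupp.degree_eq_sum, Fin.sum_univ_two] at hs'
  obtain ⟨i, j, hi, hj, hij⟩ : ∃ i j, i ≤ s 0 ∧ j ≤ s 1 ∧ i + j = e := by
    refine ⟨min e (s 0), e - min e (s 0), ?_, ?_, ?_⟩ <;> omega
  have hmem : (X 0 ^ i * X 1 ^ j : MvPolynomial (Fin 2) K) ∈ I :=
    h _ (hij ▸ (isHomogeneous_X_pow 0 i).mul (isHomogeneous_X_pow 1 j))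
  rw [monomial_eq, Finsupp.prod_fintype _ _ (by simp), Fin.prod_univ_two]
  refine I.mem_of_dvd ?_ hmem
  exact (mul_dvd_mul (pow_dvd_pow _ hi) (pow_dvd_pow _ hj)).mul_left _

theorem length_quotient_eq_of_surjective {R M : Type*} [CommRing R] [Algebra K R] [AddCommGroup M]
    [Module K M] {J : Ideal R} (T : R →ₗ[K] M) (hT : Function.Surjective T)
    (hker : LinearMap.ker T = J.restrictScalars K) :
    Module.length K (R ⧸ J) = Module.length K M :=
  (((Submodule.Quotient.restrictScalarsEquiv K J).symm.trans
    (Submodule.quotEquivOfEq _ _ hker.symm)).trans (T.quotKerEquivOfSurjective hT)).length_eq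

/-- The degree `e` piece of the quotient by `(x ^ m, y ^ n, (x + y) ^ c)`, dehomogenized. -/
def Cokernel (K : Type*) [Field K] (m n c e : ℕ) : Type _ :=
  degreeLT K (e + 1) ⧸ LinearMap.range (combination K m n c e)

noncomputable instance (m n c e : ℕ) : AddCommGroup (Cokernel K m n c e) :=
  inferInstanceAs (AddCommGroup (_ ⧸ LinearMap.range (combination K m n c e)))

noncomputable instance (m n c e : ℕ) : Module K (Cokernel K m n c e) :=
  inferInstanceAs (Module K (_ ⧸ LinearMap.range (combination K m n c e)))

instance (m n c e : ℕ) : Module.Finite K (Cokernel K m n c e) :=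
  inferInstanceAs (Module.Finite K (_ ⧸ LinearMap.range (combination K m n c e)))

theorem finrank_cokernel {m n c e : ℕ} (h : Function.Injective (combination K m n c e)) :
    Module.finrank K (Cokernel K m n c e) =
      e + 1 - ((e + 1 - m) + ((e + 1 - n) + (e + 1 - c))) := by
  change Module.finrank K (_ ⧸ LinearMap.range (combination K m n c e)) = _
  rw [Submodule.finrank_quotient, LinearMap.finrank_range_of_inj h, Module.finrank_prod,
    Module.finrank_prod, finrank_degreeLT, finrank_degreeLT, finrank_degreeLT, finrank_degreeLT]

/-- The projection onto the degree `e` piece of the quotient by `(x ^ m, y ^ n, (x + y) ^ c)`. -/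
noncomputable def toCokernel (K : Type*) [Field K] (m n c e : ℕ) :
    MvPolynomial (Fin 2) K →ₗ[K] Cokernel K m n c e :=
  (LinearMap.range (combination K m n c e)).mkQ ∘ₗ
    (dehomogenize e).codRestrict _ (dehomogenize_mem_degreeLT e)

theorem exists_toCokernel_homogenize_eq {m n c e : ℕ} (y : Cokernel K m n c e) :
    ∃ q : Polynomial K, toCokernel K m n c e (homogenize q e) = y ∧
      ∀ d ≠ e, toCokernel K m n c d (homogenize q e) = 0 := by
  obtain ⟨q, rfl⟩ := Submodule.mkQ_surjective _ y
  refine ⟨q, ?_, fun d hd => ?_⟩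
  · refine congrArg (LinearMap.range (combination K m n c e)).mkQ (Subtype.ext ?_)
    exact dehomogenize_homogenize q.2
  · refine (congrArg (LinearMap.range (combination K m n c d)).mkQ (Subtype.ext ?_)).trans
      (map_zero _)
    exact dehomogenize_homogenize_of_ne _ hd

theorem toCokernel_eq_zero_iff {m n c e : ℕ} {f : MvPolynomial (Fin 2) K} :
    toCokernel K m n c e f = 0 ↔
      ∃ t, (combination K m n c e t : Polynomial K) = dehomogenize e f := by
  refine (Submodule.Quotient.mk_eq_zero _).trans (LinearMap.mem_range.trans ?_)
  simp only [Subtype.ext_iff, LinearMap.codRestrict_apply]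

/-- The graded pieces below degree `E` of the quotient by `(x ^ m, y ^ n, (x + y) ^ c)`. -/
noncomputable def toCokernels (K : Type*) [Field K] (m n c E : ℕ) :
    MvPolynomial (Fin 2) K →ₗ[K]
      ((e : Fin E) → Cokernel K m n c e) :=
  LinearMap.pi fun e => toCokernel K m n c e

theorem toCokernels_surjective (m n c E : ℕ) : Function.Surjective (toCokernels K m n c E) := by
  intro y
  choose q hq hq' using fun e => exists_toCokernel_homogenize_eq (y e)
  refine ⟨∑ e, homogenize (q e) e, ?_⟩
  ext e
  rw [toCokernels, LinearMap.pi_apply, map_sum, Finset.sum_eq_single e, hq]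
  · intro d _ hd
    exact hq' d e fun h => hd (Fin.ext h.symm)
  · simp

theorem ker_toCokernels {m n c E : ℕ}
    (h : ∀ f : MvPolynomial (Fin 2) K, f.IsHomogeneous E → f ∈ powerIdeal K m n c) :
    LinearMap.ker (toCokernels K m n c E) = (powerIdeal K m n c).restrictScalars K := by
  ext f
  have hker : f ∈ LinearMap.ker (toCokernels K m n c E) ↔
      ∀ e : Fin E, ∃ t, (combination K m n c e t : Polynomial K) = dehomogenize e f := by
    refine LinearMap.mem_ker.trans (_root_.funext_iff.trans (forall_congr' fun e => ?_))
    exact toCokernel_eq_zero_iff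
  rw [hker, Submodule.restrictScalars_mem]
  refine ⟨fun hf => ?_, fun hf e => exists_combination_of_mem hf e⟩
  rw [← sum_homogeneousComponent f]
  refine sum_mem fun e _ => ?_
  by_cases he : e < E
  · obtain ⟨t, ht⟩ := hf ⟨e, he⟩
    rw [← homogenize_dehomogenize, ← ht]
    exact homogenize_combination_mem t
  · exact mem_of_isHomogeneous_of_le h (not_lt.mp he) (homogeneousComponent_isHomogeneous e f)

/-- The length of the quotient by `(x ^ m, y ^ n, (x + y) ^ c)` as a sum over degrees. -/
theorem length_quotient_powerIdeal {m n c E : ℕ}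
    (h : ∀ f : MvPolynomial (Fin 2) K, f.IsHomogeneous E → f ∈ powerIdeal K m n c)
    (hinj : ∀ e < E, Function.Injective (combination K m n c e)) :
    Module.length K (MvPolynomial (Fin 2) K ⧸ powerIdeal K m n c) =
      (∑ e ∈ Finset.range E, (e + 1 - ((e + 1 - m) + ((e + 1 - n) + (e + 1 - c)))) : ℕ) := by
  rw [length_quotient_eq_of_surjective (toCokernels K m n c E) (toCokernels_surjective m n c E)
    (ker_toCokernels h),
    Module.length_eq_finrank, Module.finrank_pi_fintype, Finset.sum_range]
  congr 1
  exact Finset.sum_congr rfl fun e _ => finrank_cokernel (hinj e e.2)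

theorem two_mul_sum_range_add_one_sub {E m : ℕ} (h : m ≤ E) :
    2 * ∑ e ∈ Finset.range E, ((e + 1 - m : ℕ) : ℤ) = ((E : ℤ) - m) * (E - m + 1) := by
  obtain ⟨k, rfl⟩ := Nat.exists_eq_add_of_le h
  rw [Finset.sum_range_add, Finset.sum_eq_zero (by
    intro i hi
    rw [Finset.mem_range] at hi
    rw [Nat.sub_eq_zero_of_le hi, Nat.cast_zero])]
  simp only [add_assoc, Nat.add_sub_cancel_left]
  induction k with
  | zero => simp
  | succ k ih =>
    rw [Finset.sum_range_succ, zero_add] at *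
    have := ih (by omega)
    push_cast at *
    linarith

/-- The length of the quotient by `(x ^ m, y ^ n, (x + y) ^ c)` for exponents that satisfy the
strict triangle inequalities and add up to less than twice the characteristic. -/
theorem exists_length_quotient_powerIdeal {p : ℕ} [CharP K p] {m n c : ℕ} (hm : 1 ≤ m)
    (hc : 1 ≤ c) (hmn : c < m + n) (hmc : n < m + c) (hnc : m < n + c) (hp : m + n + c < 2 * p) :
    ∃ l : ℕ, Module.length K (MvPolynomial (Fin 2) K ⧸ powerIdeal K m n c) = l ∧
      4 * (l : ℤ) = 2 * m * n + 2 * m * c + 2 * n * c - m ^ 2 - n ^ 2 - c ^ 2 +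
        ((m + n + c) % 2 : ℕ) := by
  set E := (m + n + c - 1) / 2 with hE
  have hinj : ∀ e < E, Function.Injective (combination K m n c e) := fun e he =>
    combination_injective (p := p) hm hc (by omega) (by omega) (by omega) (by omega) (by omega)
  refine ⟨_, length_quotient_powerIdeal (fun f hf => ?_) hinj, ?_⟩
  · rcases Nat.even_or_odd' (m + n + c) with ⟨k, hk | hk⟩
    · exact mem_powerIdeal_of_isHomogeneous (combination_surjective (p := p) hm hc (by omega)
        (by omega) (by omega) (by omega) (by omega)) hf
    · have hle : powerIdeal K (m + 1) n c ≤ powerIdeal K m n c := by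
        rw [powerIdeal, Ideal.span_le]
        rintro g (rfl | rfl | rfl)
        · exact Ideal.mem_of_dvd _ (pow_dvd_pow _ (Nat.le_succ m))
            (Ideal.subset_span (Set.mem_insert _ _))
        · exact Ideal.subset_span (by simp)
        · exact Ideal.subset_span (by simp)
      exact hle (mem_powerIdeal_of_isHomogeneous (combination_surjective (p := p) (by omega) hc
        (by omega) (by omega) (by omega) (by omega) (by omega)) hf)
  · have hsum : ((∑ e ∈ Finset.range E,
        (e + 1 - ((e + 1 - m) + ((e + 1 - n) + (e + 1 - c)))) : ℕ) : ℤ) =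
        ∑ e ∈ Finset.range E, ((e + 1 - 0 : ℕ) : ℤ) - ∑ e ∈ Finset.range E, ((e + 1 - m : ℕ) : ℤ)
        - ∑ e ∈ Finset.range E, ((e + 1 - n : ℕ) : ℤ)
        - ∑ e ∈ Finset.range E, ((e + 1 - c : ℕ) : ℤ) := by
      rw [Nat.cast_sum, ← Finset.sum_sub_distrib, ← Finset.sum_sub_distrib,
        ← Finset.sum_sub_distrib]
      refine Finset.sum_congr rfl fun e he => ?_
      rw [Finset.mem_range] at he
      omega
    have h0 := two_mul_sum_range_add_one_sub (Nat.zero_le E)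
    have h1 := two_mul_sum_range_add_one_sub (show m ≤ E by omega)
    have h2 := two_mul_sum_range_add_one_sub (show n ≤ E by omega)
    have h3 := two_mul_sum_range_add_one_sub (show c ≤ E by omega)
    rw [hsum]
    have hEs : (2 * E + 2 : ℤ) = m + n + c + ((m + n + c) % 2 : ℕ) := by omega
    rcases Nat.mod_two_eq_zero_or_one (m + n + c) with h | h <;> rw [h] at hEs ⊢ <;>
    push_cast at h0 hEs ⊢
    · have hm' : (m : ℤ) = 2 * E + 2 - n - c := by linarith
      rw [hm'] at h1 ⊢
      linear_combination 2 * h0 - 2 * h1 - 2 * h2 - 2 * h3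
    · have hm' : (m : ℤ) = 2 * E + 1 - n - c := by linarith
      rw [hm'] at h1 ⊢
      linear_combination 2 * h0 - 2 * h1 - 2 * h2 - 2 * h3

/-- Additivity of the length along multiplication by an element. -/
theorem length_quotient_eq_add {R : Type*} [CommRing R] [Algebra K R] {I J L : Ideal R} {f : R}
    (hJ : ∀ z, z ∈ J ↔ f * z ∈ I) (hL : L = I ⊔ Ideal.span {f}) :
    Module.length K (R ⧸ I) = Module.length K (R ⧸ J) + Module.length K (R ⧸ L) := by
  let μ : R →ₗ[K] R ⧸ I := (Ideal.Quotient.mkₐ K I).toLinearMap ∘ₗ LinearMap.mulLeft K f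
  have hIL : I ≤ L := hL ▸ le_sup_left
  let π : R ⧸ I →ₗ[K] R ⧸ L := (Ideal.Quotient.factorₐ K hIL).toLinearMap
  have hμ : ∀ z, μ z = Ideal.Quotient.mk I (f * z) := fun z => rfl
  have hker : LinearMap.ker μ = J.restrictScalars K := by
    ext z
    rw [LinearMap.mem_ker, hμ, Ideal.Quotient.eq_zero_iff_mem, ← hJ, Submodule.restrictScalars_mem]
  have hrange : LinearMap.range μ = LinearMap.ker π := by
    ext y
    obtain ⟨z, rfl⟩ := Ideal.Quotient.mk_surjective y
    have : π (Ideal.Quotient.mk I z) = Ideal.Quotient.mk L z := rfl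
    rw [LinearMap.mem_ker, this, Ideal.Quotient.eq_zero_iff_mem, hL, Submodule.mem_sup,
      LinearMap.mem_range]
    constructor
    · rintro ⟨w, hw⟩
      rw [hμ, Ideal.Quotient.eq] at hw
      exact ⟨-(f * w - z), neg_mem hw, f * w, Ideal.mem_span_singleton'.mpr ⟨w, mul_comm _ _⟩,
        by ring⟩
    · rintro ⟨i, hi, _, hw, rfl⟩
      obtain ⟨w, rfl⟩ := Ideal.mem_span_singleton'.mp hw
      refine ⟨w, ?_⟩
      rw [hμ, Ideal.Quotient.eq]
      have : f * w - (i + w * f) = -i := by ring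
      rw [this]
      exact neg_mem hi
  rw [length_quotient_eq_of_surjective (J := J) μ.rangeRestrict μ.surjective_rangeRestrict
    (by rw [LinearMap.ker_rangeRestrict, hker]), hrange]
  exact Module.length_eq_add_of_exact (LinearMap.ker π).subtype π (Submodule.injective_subtype _)
    (Ideal.Quotient.factor_surjective hIL) (LinearMap.exact_subtype_ker_map π)

theorem finrank_eq_of_length_eq {M : Type*} [AddCommGroup M] [Module K M] {l : ℕ}
    (h : Module.length K M = l) : Module.finrank K M = l := by
  rw [Module.length_eq_rank, Cardinal.toENat_eq_natCast] at h
  exact Module.finrank_eq_of_rank_eq h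

/-- The length of a quotient by two elements is additive in products. -/
theorem length_quotient_span_pair_mul {R : Type*} [CommRing R] [IsDomain R]
    [DecompositionMonoid R] [Algebra K R] {f₁ f₂ g : R} (h0 : f₂ ≠ 0) (h : IsRelPrime f₂ g) :
    Module.length K (R ⧸ Ideal.span {f₁ * f₂, g}) =
      Module.length K (R ⧸ Ideal.span {f₁, g}) + Module.length K (R ⧸ Ideal.span {f₂, g}) := by
  refine length_quotient_eq_add (f := f₂) (fun z => ?_) (le_antisymm ?_ ?_)
  · simp only [Ideal.mem_span_pair]
    constructor
    · rintro ⟨a, b, rfl⟩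
      exact ⟨a, f₂ * b, by ring⟩
    · rintro ⟨a, b, hab⟩
      obtain ⟨b', rfl⟩ := h.dvd_of_dvd_mul_right (y := b)
        ⟨z - a * f₁, by linear_combination hab⟩
      exact ⟨a, b', mul_left_cancel₀ h0 (by linear_combination hab)⟩
  · rw [Ideal.span_le, Set.insert_subset_iff, Set.singleton_subset_iff]
    exact ⟨Ideal.mem_sup_right (Ideal.mem_span_singleton_self _),
      Ideal.mem_sup_left (Ideal.subset_span (by simp))⟩
  · rw [sup_le_iff, Ideal.span_le, Ideal.span_le, Set.insert_subset_iff,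
      Set.singleton_subset_iff, Set.singleton_subset_iff]
    exact ⟨⟨Ideal.mul_mem_left _ _ (Ideal.subset_span (by simp)), Ideal.subset_span (by simp)⟩,
      Ideal.subset_span (by simp)⟩

theorem length_quotient_span_pow_left {R : Type*} [CommRing R] [IsDomain R]
    [DecompositionMonoid R] [Algebra K R] {f g : R} (h0 : f ≠ 0) (h : IsRelPrime f g) (m : ℕ) :
    Module.length K (R ⧸ Ideal.span {f ^ m, g}) =
      m * Module.length K (R ⧸ Ideal.span {f, g}) := by
  induction m with
  | zero =>
    rw [pow_zero, Ideal.span_insert, Ideal.span_singleton_one, top_sup_eq, Nat.cast_zero, zero_mul]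
    exact Module.length_eq_zero_iff.mpr (Ideal.Quotient.subsingleton_iff.mpr rfl)
  | succ m ih =>
    rw [pow_succ, length_quotient_span_pair_mul h0 h, ih]
    push_cast
    ring

theorem length_quotient_span_pow_pow {R : Type*} [CommRing R] [IsDomain R]
    [DecompositionMonoid R] [Algebra K R] {f g : R} (hf : f ≠ 0) (hg : g ≠ 0)
    (h : IsRelPrime f g) (h1 : Module.length K (R ⧸ Ideal.span {f, g}) = 1) (m n : ℕ) :
    Module.length K (R ⧸ Ideal.span {f ^ m, g ^ n}) = (m * n : ℕ) := by
  rw [length_quotient_span_pow_left hf h.pow_right, Set.pair_comm,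
    length_quotient_span_pow_left hg h.symm, Set.pair_comm, h1, mul_one, Nat.cast_mul]

theorem not_X_zero_dvd_X_one : ¬ (X 0 : MvPolynomial (Fin 2) K) ∣ X 1 := by
  rw [X_dvd_X]
  simp

theorem isRelPrime_X_zero_X_one : IsRelPrime (X 0 : MvPolynomial (Fin 2) K) (X 1) :=
  (X_prime.irreducible.isRelPrime_iff_not_dvd).mpr not_X_zero_dvd_X_one

theorem isRelPrime_X_zero_X_add_X : IsRelPrime (X 0 : MvPolynomial (Fin 2) K) (X 0 + X 1) :=
  (X_prime.irreducible.isRelPrime_iff_not_dvd).mpr fun h =>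
    not_X_zero_dvd_X_one ((dvd_add_right dvd_rfl).mp h)

theorem span_X_zero_X_add_X :
    Ideal.span {(X 0 : MvPolynomial (Fin 2) K), X 0 + X 1} = Ideal.span {X 0, X 1} := by
  ext z
  simp only [Ideal.mem_span_pair]
  constructor
  · rintro ⟨a, b, rfl⟩
    exact ⟨a + b, b, by ring⟩
  · rintro ⟨a, b, rfl⟩
    exact ⟨a - b, b, by ring⟩

theorem powerIdeal_eq_span_pair {m n c : ℕ} (h : m + c ≤ n + 1) :
    powerIdeal K m n c = Ideal.span {X 0 ^ m, (X 0 + X 1) ^ c} := by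
  have hmem : (X 1 ^ n : MvPolynomial (Fin 2) K) ∈ Ideal.span {X 0 ^ m, (X 0 + X 1) ^ c} := by
    have h1 : (X 1 : MvPolynomial (Fin 2) K) = -X 0 + (X 0 + X 1) := by ring
    rw [h1]
    refine Ideal.add_pow_mem_of_pow_mem_of_le (m := m) (n := c) _ ?_ ?_ h
    · rw [neg_pow]
      exact Ideal.mul_mem_left _ _ (Ideal.subset_span (by simp))
    · rw [← h1]
      exact Ideal.subset_span (by simp)
  rw [powerIdeal, Set.insert_comm, Ideal.span_insert, sup_eq_right, Ideal.span_singleton_le_iff_mem]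
  exact hmem

theorem length_quotient_span_X_X {p : ℕ} [CharP K p] (hp : 2 ≤ p) : Module.length K
    (MvPolynomial (Fin 2) K ⧸ Ideal.span {(X 0 : MvPolynomial (Fin 2) K), X 1}) = 1 := by
  have h : powerIdeal K 1 1 1 = Ideal.span {X 0, X 1} := by
    rw [powerIdeal_eq_span_pair le_rfl, pow_one, pow_one, span_X_zero_X_add_X]
  obtain ⟨l, hl, hl'⟩ := exists_length_quotient_powerIdeal (K := K) (p := p) (m := 1) (n := 1)
    (c := 1) le_rfl le_rfl (by omega) (by omega) (by omega) (by omega)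
  have hl1 : l = 1 := by
    norm_num at hl'
    omega
  rw [← h, hl, hl1, Nat.cast_one]

/-- Dividing out `x ^ a y ^ b`. -/
theorem length_quotient_span_mul_monomial (m n a b : ℕ) (h : MvPolynomial (Fin 2) K) :
    Module.length K (MvPolynomial (Fin 2) K ⧸ Ideal.span
        ({X 0 ^ (m + a), X 1 ^ (n + b), X 0 ^ a * X 1 ^ b * h} : Set (MvPolynomial (Fin 2) K))) =
      Module.length K (MvPolynomial (Fin 2) K ⧸ Ideal.span
        ({X 0 ^ m, X 1 ^ n, h} : Set (MvPolynomial (Fin 2) K))) +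
      Module.length K (MvPolynomial (Fin 2) K ⧸ Ideal.span
        ({X 0 ^ (m + a), X 1 ^ (n + b), X 0 ^ a * X 1 ^ b} : Set (MvPolynomial (Fin 2) K))) := by
  have ha0 : (X 0 : MvPolynomial (Fin 2) K) ^ a ≠ 0 := pow_ne_zero _ (X_ne_zero 0)
  have hb0 : (X 1 : MvPolynomial (Fin 2) K) ^ b ≠ 0 := pow_ne_zero _ (X_ne_zero 1)
  have hrel : ∀ i j, IsRelPrime (X 0 ^ i : MvPolynomial (Fin 2) K) (X 1 ^ j) := fun i j =>
    isRelPrime_X_zero_X_one.pow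
  refine length_quotient_eq_add (f := X 0 ^ a * X 1 ^ b) (fun z => ?_) (le_antisymm ?_ ?_)
  · simp only [mem_span_triple]
    constructor
    · rintro ⟨u, v, w, rfl⟩
      exact ⟨u * X 1 ^ b, v * X 0 ^ a, w, by ring⟩
    · rintro ⟨u, v, w, hz⟩
      rw [pow_add, pow_add] at hz
      obtain ⟨v', rfl⟩ := (hrel a (n + b)).dvd_of_dvd_mul_right (y := v)
        ⟨X 1 ^ b * z - u * X 0 ^ m - w * X 1 ^ b * h, by rw [pow_add]; linear_combination hz⟩
      obtain ⟨u', rfl⟩ := (hrel (m + a) b).symm.dvd_of_dvd_mul_right (y := u)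
        ⟨X 0 ^ a * z - X 0 ^ a * v' * X 1 ^ n - w * X 0 ^ a * h, by
          rw [pow_add]; linear_combination hz⟩
      exact ⟨u', v', w, mul_left_cancel₀ (mul_ne_zero ha0 hb0) (by linear_combination hz)⟩
  · rw [Ideal.span_le]
    rintro g (rfl | rfl | rfl)
    · exact Ideal.mem_sup_left (Ideal.subset_span (by simp))
    · exact Ideal.mem_sup_left (Ideal.subset_span (by simp))
    · exact Ideal.mem_sup_right (Ideal.mem_span_singleton_self _)
  · rw [sup_le_iff, Ideal.span_le, Ideal.span_singleton_le_iff_mem]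
    refine ⟨?_, Ideal.subset_span (by simp)⟩
    rintro g (rfl | rfl | rfl)
    · exact Ideal.subset_span (by simp)
    · exact Ideal.subset_span (by simp)
    · exact Ideal.mul_mem_right _ _ (Ideal.subset_span (by simp))

/-- The length of the quotient by `(x ^ p, y ^ p, x ^ a y ^ b (x + y) ^ c)` in terms of the length
of the quotient by `(x ^ (p - a), y ^ (p - b), (x + y) ^ c)`. -/
theorem finrank_quotient_add {p m n a b c l : ℕ} [CharP K p] (hp : 2 ≤ p)
    (hma : m + a = p) (hnb : n + b = p)
    (hl : Module.length K (MvPolynomial (Fin 2) K ⧸ powerIdeal K m n c) = l) :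
    Module.finrank K (MvPolynomial (Fin 2) K ⧸ Ideal.span
      ({X 0 ^ p, X 1 ^ p, X 0 ^ a * X 1 ^ b * (X 0 + X 1) ^ c} : Set (MvPolynomial (Fin 2) K))) +
        m * n = p * p + l := by
  have hpair := length_quotient_span_pow_pow (K := K) (X_ne_zero (0 : Fin 2)) (X_ne_zero 1)
    isRelPrime_X_zero_X_one (length_quotient_span_X_X hp)
  have hz := length_quotient_span_mul_monomial (K := K) m n a b 0
  have hI := length_quotient_span_mul_monomial (K := K) m n a b ((X 0 + X 1) ^ c)
  have htriple : ∀ f g : MvPolynomial (Fin 2) K, Ideal.span {f, g, 0} = Ideal.span {f, g} := by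
    intro f g
    rw [Ideal.span_insert, Set.pair_comm, Ideal.span_insert_zero, ← Ideal.span_insert]
  rw [hma, hnb, mul_zero, htriple, htriple, hpair, hpair] at hz
  rw [hma, hnb, ← powerIdeal, hl] at hI
  generalize Module.length K (MvPolynomial (Fin 2) K ⧸ Ideal.span
    ({X 0 ^ p, X 1 ^ p, X 0 ^ a * X 1 ^ b} : Set (MvPolynomial (Fin 2) K))) = k at hI hz
  lift k to ℕ using fun htop => by
    rw [htop, add_top] at hz
    exact ENat.natCast_ne_top _ hz
  rw [finrank_eq_of_length_eq (l := l + k) (by rw [hI, Nat.cast_add])]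
  have : p * p = m * n + k := by exact_mod_cast hz
  omega

end MvPolynomial

open MvPolynomial

/-- Exact lengths `ℓ(𝔽_p[x,y]/(x^p, y^p, f^r))` for `f = x^a y^b (x+y)^c` with
`a ≥ b ≥ c ≥ 0`, `r ≥ 1`, `ar < p`, and `(a+b+c)r < 2p`. -/
theorem stmt17 (p : ℕ) (hp : p.Prime) (a b c r : ℕ) (hba : b ≤ a) (hcb : c ≤ b)
    (hr : 1 ≤ r) (har : a * r < p) (habcr : (a + b + c) * r < 2 * p) :
    (b + c ≤ a →
      (Module.finrank (ZMod p) (MvPolynomial (Fin 2) (ZMod p) ⧸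
          Ideal.span ({X 0 ^ p, X 1 ^ p, (X 0 ^ a * X 1 ^ b * (X 0 + X 1) ^ c) ^ r} :
            Set (MvPolynomial (Fin 2) (ZMod p)))) : ℤ)
        = ((a : ℤ) + b + c) * r * p - (a : ℤ) * ((b : ℤ) + c) * (r : ℤ) ^ 2) ∧
    (a < b + c →
      (Module.finrank (ZMod p) (MvPolynomial (Fin 2) (ZMod p) ⧸
          Ideal.span ({X 0 ^ p, X 1 ^ p, (X 0 ^ a * X 1 ^ b * (X 0 + X 1) ^ c) ^ r} :
            Set (MvPolynomial (Fin 2) (ZMod p)))) : ℤ)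
        = ((a : ℤ) + b + c) * r * p - ((a : ℤ) + b + c) ^ 2 * (r : ℤ) ^ 2 / 4) := by
  have : Fact p.Prime := ⟨hp⟩
  have hbr : b * r ≤ a * r := Nat.mul_le_mul_right r hba
  have hcr : c * r ≤ b * r := Nat.mul_le_mul_right r hcb
  obtain ⟨m, hm⟩ : ∃ m, m + a * r = p := ⟨p - a * r, by omega⟩
  obtain ⟨n, hn⟩ : ∃ n, n + b * r = p := ⟨p - b * r, by omega⟩
  have hmz : (m : ℤ) = p - a * r := by rw [← hm]; push_cast; ring
  have hnz : (n : ℤ) = p - b * r := by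
    have : ((n + b * r : ℕ) : ℤ) = p := congrArg _ hn
    push_cast at this
    linarith
  rw [show ((X 0 ^ a * X 1 ^ b * (X 0 + X 1) ^ c) ^ r : MvPolynomial (Fin 2) (ZMod p)) =
    X 0 ^ (a * r) * X 1 ^ (b * r) * (X 0 + X 1) ^ (c * r) by
      rw [mul_pow, mul_pow, ← pow_mul, ← pow_mul, ← pow_mul]]
  constructor
  · intro habc
    have hle : b * r + c * r ≤ a * r := by rw [← add_mul]; exact Nat.mul_le_mul_right r habc
    have hl : Module.length (ZMod p) (MvPolynomial (Fin 2) (ZMod p) ⧸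
        powerIdeal (ZMod p) m n (c * r)) = (m * (c * r) : ℕ) := by
      rw [powerIdeal_eq_span_pair (by omega)]
      refine length_quotient_span_pow_pow (X_ne_zero 0) (fun h => ?_) isRelPrime_X_zero_X_add_X
        (by rw [span_X_zero_X_add_X, length_quotient_span_X_X hp.two_le]) _ _
      have h' := isRelPrime_X_zero_X_add_X (K := ZMod p)
      rw [h, isRelPrime_zero_right] at h'
      exact X_prime.not_isUnit h'
    have h := congrArg (Nat.cast : ℕ → ℤ) (finrank_quotient_add hp.two_le hm hn hl)
    push_cast at h
    rw [hmz, hnz] at h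
    linear_combination h
  · intro habc
    have hlt : a * r < b * r + c * r := by
      rw [← add_mul]; exact Nat.mul_lt_mul_of_pos_right habc hr
    rw [add_mul, add_mul] at habcr
    obtain ⟨l, hl, hl'⟩ := exists_length_quotient_powerIdeal (K := ZMod p) (p := p) (m := m)
      (n := n) (c := c * r) (by omega) (by omega) (by omega) (by omega) (by omega) (by omega)
    have h := congrArg (Nat.cast : ℕ → ℤ) (finrank_quotient_add hp.two_le hm hn hl)
    push_cast at h
    have hpar : (m + n + c * r) % 2 = (a * r + b * r + c * r) % 2 := by omega
    rw [hpar] at hl'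
    have hsq : ((a : ℤ) + b + c) ^ 2 * (r : ℤ) ^ 2 =
        4 * (((a : ℤ) + b + c) ^ 2 * (r : ℤ) ^ 2 / 4) +
          ((a * r + b * r + c * r) % 2 : ℕ) := by
      have hz : ((a : ℤ) + b + c) ^ 2 * (r : ℤ) ^ 2 = ((a * r + b * r + c * r : ℕ) : ℤ) ^ 2 := by
        push_cast; ring
      rw [hz]
      rcases Nat.even_or_odd' (a * r + b * r + c * r) with ⟨k, hk | hk⟩ <;> rw [hk] <;>
        push_cast
      · have : ((2 : ℤ) * k) ^ 2 = 4 * k ^ 2 := by ring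
        rw [this]
        omega
      · have : ((2 : ℤ) * k + 1) ^ 2 = 4 * (k ^ 2 + k) + 1 := by ring
        rw [this]
        omega
    generalize ((a : ℤ) + b + c) ^ 2 * (r : ℤ) ^ 2 / 4 = q at hsq ⊢
    generalize ((a * r + b * r + c * r) % 2 : ℕ) = ε at hsq hl'
    push_cast at hl'
    rw [hmz, hnz] at h hl'
    apply mul_left_cancel₀ (show (4 : ℤ) ≠ 0 by norm_num)
    linear_combination 4 * h + hl' - hsq
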